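/- Let J be a unital Jordan algebra over a field F of characteristic different from 2 and 3, let d be a derivation with invertible values of J, and let M be the sum (supremum as F-subspaces) of all ideals of J contained in ker d. Then M is a proper ideal of J, M ⊆ ker d, a b = 0 for all a, b in M, and every proper ideal of J is contained in M; in particular M is the largest proper ideal of J. -/

import Mathlib

theorem jordan_lin_aux (F : Type*) [Field F] (h2 : (2 : F) ≠ 0)
    (J : Type*) [NonAssocRing J] [Module F J]
    (hcomm : ∀ x y : J, x * y = y * x)
    (hjordan : ∀ x y : J, ((x * x) * y) * x = (x * x) * (y * x)) (a b y c : J) :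
    ((a * b) * y) * c + a * (y * (b * c)) + b * (y * (a * c))
      = (a * b) * (y * c) + (y * a) * (b * c) + (y * b) * (a * c) := by
  have key : (2 : F) • (((a * b) * y) * c + a * (y * (b * c)) + b * (y * (a * c)))
      = (2 : F) • ((a * b) * (y * c) + (y * a) * (b * c) + (y * b) * (a * c)) := by
    have e1 := hjordan (a + b + c) y
    have e2 := hjordan (a + b) y
    have e3 := hjordan (b + c) y
    have e4 := hjordan (a + c) y
    have e5 := hjordan a y
    have e6 := hjordan b y
    have e7 := hjordan c y
    rw [two_smul, two_smul]
    have c1 : a * (y * (b * c)) = ((b * c) * y) * a := by rw [hcomm a, hcomm y]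
    have c2 : b * (y * (a * c)) = ((a * c) * y) * b := by rw [hcomm b, hcomm y]
    have c3 : (y * a) * (b * c) = (b * c) * (y * a) := hcomm _ _
    have c4 : (y * b) * (a * c) = (a * c) * (y * b) := hcomm _ _
    rw [c1, c2, c3, c4]
    simp only [mul_add, add_mul, hcomm b a, hcomm c a, hcomm c b] at e1 e2 e3 e4
    linear_combination (norm := abel) e1 - e2 - e3 - e4 + e5 + e6 + e7
  have h := congrArg (fun z => (2 : F)⁻¹ • z) key
  simpa [smul_smul, inv_mul_cancel₀ h2] using h

/-- From Kaygorodov–Lopatin–Popov: Jordan algebras admitting derivations with invertible values. -/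
theorem jordan_der_inv_values_largest_ideal2 (F : Type*) [Field F] (h2 : (2 : F) ≠ 0) (h3 : (3 : F) ≠ 0)
    (J : Type*) [NonAssocRing J] [Module F J] [SMulCommClass F J J] [IsScalarTower F J J]
    (hcomm : ∀ x y : J, x * y = y * x)
    (hjordan : ∀ x y : J, ((x * x) * y) * x = (x * x) * (y * x))
    (d : J →ₗ[F] J) (hder : ∀ a b : J, d (a * b) = d a * b + a * d b)
    (hd0 : d ≠ 0)
    (hdinv : ∀ x : J, d x = 0 ∨ ∃ y : J, d x * y = 1 ∧ (d x * d x) * y = d x)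
    (M : Submodule F J)
    (hM : M = sSup {I : Submodule F J |
      (∀ x ∈ I, ∀ j : J, j * x ∈ I) ∧ ∀ x ∈ I, d x = 0}) :
    (∀ x ∈ M, ∀ j : J, j * x ∈ M) ∧ M ≠ ⊤ ∧ (∀ x ∈ M, d x = 0) ∧
      (∀ a ∈ M, ∀ b ∈ M, a * b = 0) ∧
      ∀ I : Submodule F J, (∀ x ∈ I, ∀ j : J, j * x ∈ I) → I ≠ ⊤ → I ≤ M := by
  have lin := jordan_lin_aux F h2 J hcomm hjordan
  have hMker : ∀ x ∈ M, d x = 0 := by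
    have : M ≤ LinearMap.ker d := by
      rw [hM]
      exact sSup_le fun I hI x hx => hI.2 x hx
    exact fun x hx => this hx
  have hMid : ∀ x ∈ M, ∀ j : J, j * x ∈ M := by
    intro x hx j
    have : M ≤ M.comap (LinearMap.mulLeft F j) := by
      conv_lhs => rw [hM]
      refine sSup_le fun I hI x hx => ?_
      have h1 : I ≤ M := by rw [hM]; exact le_sSup hI
      exact h1 (hI.1 x hx j)
    exact this hx
  obtain ⟨j, hj⟩ : ∃ j, d j ≠ 0 := by
    by_contra! h
    exact hd0 (LinearMap.ext h)
  refine ⟨hMid, ?_, hMker, ?_, ?_⟩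
  · rintro rfl
    exact hj (hMker j Submodule.mem_top)
  · obtain ⟨v, huv, huuv⟩ := (hdinv j).resolve_left hj
    have hu : ∀ m ∈ M, d j * m = 0 := by
      intro m hm
      have h := hder j m
      rw [hMker _ (hMid m hm j), hMker m hm, mul_zero, add_zero] at h
      exact h.symm
    generalize d j = u at huv huuv hu
    intro m hm n hn
    have hx : m * n ∈ M := hMid n hn m
    have hux := hu _ hx
    have huux : (u * u) * (m * n) = 0 := by
      have h := lin u m u n
      simp only [hu m hm, hu n hn, hu _ hx, zero_mul, mul_zero, zero_add, add_zero] at h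
      exact h.symm
    generalize m * n = x at hx hux huux
    have hvx : v * x = 0 := by
      have h := lin u v v x
      have h1 := hu _ (hMid _ (hMid _ hx v) v)
      rw [hcomm v u, huv, h1, hux] at h
      simpa using h
    have h := lin (u * u) v v x
    rw [hcomm v (u * u), huuv, huv, hvx, huux] at h
    simpa using h
  · intro I hI hIt
    have h1 : (1 : J) ∉ I := by
      intro h
      apply hIt
      rw [eq_top_iff]
      intro x _
      simpa using hI 1 h x
    have hker : ∀ x ∈ I, d x = 0 := by
      intro x hx
      by_contra hdx
      have hmem : x * d x ∈ I := hcomm (d x) x ▸ hI x hx (d x)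
      have hz : d (x * x) = 0 := by
        refine (hdinv (x * x)).resolve_right ?_
        rintro ⟨y, hy, -⟩
        apply h1
        rw [← hy, hcomm]
        apply hI
        rw [hder]
        exact I.add_mem (hI x hx _) hmem
      have hz2 : x * d x = 0 := by
        rw [hder, hcomm (d x) x, ← two_smul F] at hz
        exact (smul_eq_zero.mp hz).resolve_left h2
      have hz3 : d x * d x ∈ I := by
        have h := hder x (d x)
        rw [hz2, map_zero] at h
        rw [eq_neg_of_add_eq_zero_left h.symm, hcomm]
        exact I.neg_mem (hI x hx _)
      obtain ⟨y, hy, hy2⟩ := (hdinv x).resolve_left hdx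
      have h4 : d x ∈ I := by
        rw [← hy2, hcomm]
        exact hI _ hz3 y
      apply h1
      rw [← hy, hcomm]
      exact hI _ h4 y
    rw [hM]
    exact le_sSup ⟨hI, hker⟩
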